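/- Let L = L₀ ⊕ L₁ be a nilpotent complex Leibniz superalgebra with dim L₀ = n and dim L₁ = m, generated by two elements x₁ ∈ L₀ and y₁ ∈ L₁, and possessing a basis y₁, y₂, …, y_m of L₁ with [y_j, x₁] = y_{j+1} for 1 ≤ j ≤ m−1 and [y_m, x₁] = 0. If dim L₀³ ≤ n − 4 (where L₀^k denotes the descending central series of the Leibniz algebra L₀), then the nilindex of L is less than n + m; equivalently, L^{n+m−1} = 0. -/

import Mathlib

/-- A complex Leibniz superalgebra structure on a vector space `V`:
a bilinear bracket together with an internal ℤ₂-grading `V = L0 ⊕ L1`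
such that the bracket respects the grading and the Leibniz superidentity
`[x,[y,z]] = [[x,y],z] − (−1)^{αβ}[[x,z],y]` holds for homogeneous `y, z`. -/
structure LeibnizSuperAlg (V : Type*) [AddCommGroup V] [Module ℂ V] where
  br : V →ₗ[ℂ] V →ₗ[ℂ] V
  L0 : Submodule ℂ V
  L1 : Submodule ℂ V
  compl : IsCompl L0 L1
  grade00 : ∀ x ∈ L0, ∀ y ∈ L0, br x y ∈ L0
  grade01 : ∀ x ∈ L0, ∀ y ∈ L1, br x y ∈ L1
  grade10 : ∀ x ∈ L1, ∀ y ∈ L0, br x y ∈ L1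
  grade11 : ∀ x ∈ L1, ∀ y ∈ L1, br x y ∈ L0
  super_ee : ∀ (x : V), ∀ y ∈ L0, ∀ z ∈ L0,
    br x (br y z) = br (br x y) z - br (br x z) y
  super_eo : ∀ (x : V), ∀ y ∈ L0, ∀ z ∈ L1,
    br x (br y z) = br (br x y) z - br (br x z) y
  super_oe : ∀ (x : V), ∀ y ∈ L1, ∀ z ∈ L0,
    br x (br y z) = br (br x y) z - br (br x z) y
  super_oo : ∀ (x : V), ∀ y ∈ L1, ∀ z ∈ L1,
    br x (br y z) = br (br x y) z + br (br x z) y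

namespace LeibnizSuperAlg

variable {V : Type*} [AddCommGroup V] [Module ℂ V]

/-- The span of all products `[u,v]` with `u ∈ S`, `v ∈ T`. -/
def prodSpan (A : LeibnizSuperAlg V) (S T : Submodule ℂ V) : Submodule ℂ V :=
  Submodule.span ℂ {z : V | ∃ u ∈ S, ∃ v ∈ T, z = A.br u v}

/-- `A.lcs k` is the `(k+1)`-st term `L^{k+1}` of the descending central series:
`L¹ = L`, `L^{k+1} = [L^k, L]`. -/
def lcs (A : LeibnizSuperAlg V) : ℕ → Submodule ℂ V
  | 0 => ⊤
  | k + 1 => A.prodSpan (lcs A k) ⊤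

/-- `A.lcs0 k` is the `(k+1)`-st term `L₀^{k+1}` of the descending central series
of the even part: `L₀¹ = L₀`, `L₀^{k+1} = [L₀^k, L₀]`. -/
def lcs0 (A : LeibnizSuperAlg V) : ℕ → Submodule ℂ V
  | 0 => A.L0
  | k + 1 => A.prodSpan (lcs0 A k) A.L0

/-- Nilpotency: some term of the descending central series vanishes. -/
def IsNilpotent (A : LeibnizSuperAlg V) : Prop := ∃ s, A.lcs s = ⊥

/-- `S` generates `L`: the smallest subspace containing `S` and closed under the
product is `L` itself. -/
def Generates (A : LeibnizSuperAlg V) (S : Set V) : Prop :=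
  ∀ W : Submodule ℂ V, S ⊆ W → (∀ u ∈ W, ∀ v ∈ W, A.br u v ∈ W) → W = ⊤

/-- The operator of right multiplication `R_x : z ↦ [z, x]`. -/
def R (A : LeibnizSuperAlg V) (x : V) : V →ₗ[ℂ] V := A.br.flip x

end LeibnizSuperAlg

namespace LeibnizSuperAlg

section Helpers

variable {V : Type*} [AddCommGroup V] [Module ℂ V]

/-- Homogeneous elements. -/
def Hom (A : LeibnizSuperAlg V) (v : V) : Prop := v ∈ A.L0 ∨ v ∈ A.L1

theorem eq_zero_of_mem (A : LeibnizSuperAlg V) {v : V} (h0 : v ∈ A.L0) (h1 : v ∈ A.L1) :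
    v = 0 := by
  have := A.compl.inf_eq_bot
  have h : v ∈ A.L0 ⊓ A.L1 := ⟨h0, h1⟩
  rw [this] at h
  simpa using h

theorem br_mem_lcs (A : LeibnizSuperAlg V) {k : ℕ} {u : V} (hu : u ∈ A.lcs k) (v : V) :
    A.br u v ∈ A.lcs (k + 1) :=
  Submodule.subset_span ⟨u, hu, v, Submodule.mem_top, rfl⟩

theorem lcs_succ_le (A : LeibnizSuperAlg V) (k : ℕ) : A.lcs (k + 1) ≤ A.lcs k := by
  induction k with
  | zero => exact le_top
  | succ k ih =>
    refine Submodule.span_le.2 ?_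
    rintro z ⟨u, hu, v, -, rfl⟩
    exact A.br_mem_lcs (ih hu) v

theorem lcs_anti (A : LeibnizSuperAlg V) : Antitone A.lcs :=
  antitone_nat_of_succ_le A.lcs_succ_le

theorem exists_decomp_top (A : LeibnizSuperAlg V) (v : V) :
    ∃ a ∈ A.L0, ∃ b ∈ A.L1, v = a + b := by
  have h : v ∈ A.L0 ⊔ A.L1 := by rw [A.compl.sup_eq_top]; trivial
  obtain ⟨a, ha, b, hb, h⟩ := Submodule.mem_sup.1 h
  exact ⟨a, ha, b, hb, h.symm⟩

theorem exists_decomp (A : LeibnizSuperAlg V) (k : ℕ) :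
    ∀ v ∈ A.lcs k, ∃ a ∈ A.L0, ∃ b ∈ A.L1, a ∈ A.lcs k ∧ b ∈ A.lcs k ∧ v = a + b := by
  induction k with
  | zero =>
    intro v _
    obtain ⟨a, ha, b, hb, h⟩ := A.exists_decomp_top v
    exact ⟨a, ha, b, hb, Submodule.mem_top, Submodule.mem_top, h⟩
  | succ k ih =>
    intro v hv
    induction hv using Submodule.span_induction with
    | mem z hz =>
      obtain ⟨u, hu, v, -, rfl⟩ := hz
      obtain ⟨a, ha, b, hb, hak, hbk, rfl⟩ := ih u hu
      obtain ⟨c, hc, d, hd, rfl⟩ := A.exists_decomp_top v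
      refine ⟨A.br a c + A.br b d, add_mem (A.grade00 a ha c hc) (A.grade11 b hb d hd),
        A.br a d + A.br b c, add_mem (A.grade01 a ha d hd) (A.grade10 b hb c hc),
        add_mem (A.br_mem_lcs hak _) (A.br_mem_lcs hbk _),
        add_mem (A.br_mem_lcs hak _) (A.br_mem_lcs hbk _), ?_⟩
      simp only [map_add, LinearMap.add_apply]
      abel
    | zero => exact ⟨0, zero_mem _, 0, zero_mem _, zero_mem _, zero_mem _, by simp⟩
    | add p q _ _ hp hq =>
      obtain ⟨a, ha, b, hb, hak, hbk, rfl⟩ := hp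
      obtain ⟨c, hc, d, hd, hck, hdk, rfl⟩ := hq
      exact ⟨a + c, add_mem ha hc, b + d, add_mem hb hd, add_mem hak hck, add_mem hbk hdk,
        by abel⟩
    | smul t p _ hp =>
      obtain ⟨a, ha, b, hb, hak, hbk, rfl⟩ := hp
      exact ⟨t • a, Submodule.smul_mem _ _ ha, t • b, Submodule.smul_mem _ _ hb,
        Submodule.smul_mem _ _ hak, Submodule.smul_mem _ _ hbk, by simp⟩

theorem br_hom_mem (A : LeibnizSuperAlg V) {k : ℕ} {u a b : V} (ha : A.Hom a) (hb : A.Hom b)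
    (h1 : A.br (A.br u a) b ∈ A.lcs k) (h2 : A.br (A.br u b) a ∈ A.lcs k) :
    A.br u (A.br a b) ∈ A.lcs k := by
  rcases ha with ha | ha <;> rcases hb with hb | hb
  · rw [A.super_ee u a ha b hb]; exact sub_mem h1 h2
  · rw [A.super_eo u a ha b hb]; exact sub_mem h1 h2
  · rw [A.super_oe u a ha b hb]; exact sub_mem h1 h2
  · rw [A.super_oo u a ha b hb]; exact add_mem h1 h2

theorem br_lcs_lcs (A : LeibnizSuperAlg V) (j : ℕ) :
    ∀ (i : ℕ) (u v : V), u ∈ A.lcs i → v ∈ A.lcs j → A.br u v ∈ A.lcs (i + j + 1) := by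
  induction j with
  | zero => intro i u v hu _; exact A.br_mem_lcs hu v
  | succ j ih =>
    intro i u v hu hv
    induction hv using Submodule.span_induction with
    | mem z hz =>
      obtain ⟨a, ha, b, -, rfl⟩ := hz
      have key : ∀ a b, a ∈ A.lcs j → A.Hom a → A.Hom b →
          A.br u (A.br a b) ∈ A.lcs (i + (j + 1) + 1) := by
        intro a b ha hha hhb
        refine A.br_hom_mem hha hhb ?_ ?_
        · exact A.br_mem_lcs (ih i u a hu ha) b
        · have := ih (i + 1) (A.br u b) a (A.br_mem_lcs hu b) ha
          rwa [show i + 1 + j + 1 = i + (j + 1) + 1 by omega] at this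
      obtain ⟨a0, h0, a1, h1, h0k, h1k, rfl⟩ := A.exists_decomp j a ha
      obtain ⟨b0, g0, b1, g1, rfl⟩ := A.exists_decomp_top b
      simp only [map_add, LinearMap.add_apply]
      exact add_mem (add_mem (key _ _ h0k (Or.inl h0) (Or.inl g0))
        (key _ _ h1k (Or.inr h1) (Or.inl g0)))
        (add_mem (key _ _ h0k (Or.inl h0) (Or.inr g1)) (key _ _ h1k (Or.inr h1) (Or.inr g1)))
    | zero => simp
    | add p q _ _ hp hq => rw [map_add]; exact add_mem hp hq
    | smul t p _ hp => rw [map_smul]; exact Submodule.smul_mem _ _ hp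

/-- An odd vector in `span a + L^k` with `a` even lies in `L^k`. -/
theorem odd_mem (A : LeibnizSuperAlg V) {k : ℕ} {a b : V} (ha : a ∈ A.L0) (hb : b ∈ A.L1)
    (h : b ∈ Submodule.span ℂ {a} ⊔ A.lcs k) : b ∈ A.lcs k := by
  obtain ⟨p, hp, q, hq, hpq⟩ := Submodule.mem_sup.1 h
  obtain ⟨c, rfl⟩ := Submodule.mem_span_singleton.1 hp
  obtain ⟨q0, h0, q1, h1, h0k, h1k, rfl⟩ := A.exists_decomp k q hq
  have e : b - q1 = c • a + q0 := by rw [← hpq]; abel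
  have : b - q1 = 0 := A.eq_zero_of_mem
    (by rw [e]; exact add_mem (Submodule.smul_mem _ _ ha) h0) (sub_mem hb h1)
  rw [sub_eq_zero.1 this]
  exact h1k

variable [FiniteDimensional ℂ V]

theorem finrank_lt_sup (S : Submodule ℂ V) {a : V} (ha : a ∉ S) :
    Module.finrank ℂ S < Module.finrank ℂ (Submodule.span ℂ {a} ⊔ S : Submodule ℂ V) := by
  apply Submodule.finrank_lt_finrank_of_lt
  refine lt_of_le_of_ne le_sup_right ?_
  intro h
  apply ha
  rw [h]
  exact Submodule.mem_sup_left (Submodule.mem_span_singleton_self a)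

theorem finrank_two (A : LeibnizSuperAlg V) {k : ℕ} {a b : V} (ha : a ∈ A.L0) (hb : b ∈ A.L1)
    (hak : a ∈ A.lcs k) (hbk : b ∈ A.lcs k) (ha' : a ∉ A.lcs (k + 1))
    (hb' : b ∉ A.lcs (k + 1)) :
    Module.finrank ℂ (A.lcs (k + 1)) + 2 ≤ Module.finrank ℂ (A.lcs k) := by
  have h1 := finrank_lt_sup _ ha'
  have h2 := finrank_lt_sup (Submodule.span ℂ {a} ⊔ A.lcs (k + 1))
    (fun h => hb' (A.odd_mem ha hb h))
  have h3 : Submodule.span ℂ {b} ⊔ (Submodule.span ℂ {a} ⊔ A.lcs (k + 1)) ≤ A.lcs k := by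
    refine sup_le ?_ (sup_le ?_ (A.lcs_succ_le k))
    · simpa using hbk
    · simpa using hak
  have h4 := Submodule.finrank_mono h3
  omega

theorem count_aux (A : LeibnizSuperAlg V) (S : Submodule ℂ V) (b : ℕ) (hb : 1 ≤ b) (r : ℕ) :
    ∀ a : ℕ, (∀ i < r, ∃ v ∈ S, v ∈ A.lcs (a + b * i) ∧ v ∉ A.lcs (a + b * i + 1)) →
      r ≤ Module.finrank ℂ (S ⊓ A.lcs a : Submodule ℂ V) := by
  induction r with
  | zero => intros; omega
  | succ r ih =>
    intro a h
    have h1 := ih (a + b) (by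
      intro i hi
      have := h (i + 1) (by omega)
      rwa [show a + b * (i + 1) = a + b + b * i by ring] at this)
    obtain ⟨v, hv, hva, hva'⟩ := h 0 (by omega)
    have h2 : (S ⊓ A.lcs (a + b) : Submodule ℂ V) < S ⊓ A.lcs a := by
      refine lt_of_le_of_ne (inf_le_inf_left _ (A.lcs_anti (by omega))) ?_
      intro e
      have : v ∈ S ⊓ A.lcs a := ⟨hv, by simpa using hva⟩
      rw [← e] at this
      exact hva' (A.lcs_anti (by simp; omega) this.2)
    have := Submodule.finrank_lt_finrank_of_lt h2
    omega

theorem count (A : LeibnizSuperAlg V) (S : Submodule ℂ V) (a b r : ℕ) (hb : 1 ≤ b)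
    (h : ∀ i < r, ∃ v ∈ S, v ∈ A.lcs (a + b * i) ∧ v ∉ A.lcs (a + b * i + 1)) :
    r ≤ Module.finrank ℂ S :=
  (A.count_aux S b hb r a h).trans (Submodule.finrank_mono inf_le_left)

/-- The situation to be refuted. -/
structure Bad (A : LeibnizSuperAlg V) (n m : ℕ) (x y : V) : Prop where
  hn : Module.finrank ℂ A.L0 = n
  hm : Module.finrank ℂ A.L1 = m
  hm1 : 1 ≤ m
  hnil : A.IsNilpotent
  hx : x ∈ A.L0
  hy : y ∈ A.L1
  hy0 : y ≠ 0
  hgen : A.Generates {x, y}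
  hdim : Module.finrank ℂ (A.lcs0 2) + 4 ≤ n
  hne : A.lcs (n + m - 2) ≠ ⊥

namespace Bad

variable {A : LeibnizSuperAlg V} {n m : ℕ} {x y : V}

theorem eq_bot (h : A.Bad n m x y) {k : ℕ} (hk : A.lcs k ≤ A.lcs (k + 1)) : A.lcs k = ⊥ := by
  obtain ⟨s, hs⟩ := h.hnil
  have : ∀ j, A.lcs k ≤ A.lcs (k + j) := by
    intro j
    induction j with
    | zero => exact le_rfl
    | succ j ih =>
      refine hk.trans (Submodule.span_le.2 ?_)
      rintro z ⟨u, hu, v, -, rfl⟩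
      exact A.br_mem_lcs (ih hu) v
  have h2 := (this s).trans (A.lcs_anti (show s ≤ k + s by omega))
  rw [hs] at h2
  exact le_bot_iff.1 h2

theorem not_le (h : A.Bad n m x y) {k : ℕ} (hk : k ≤ n + m - 2) :
    ¬ A.lcs k ≤ A.lcs (k + 1) := by
  intro hh
  have h1 := h.eq_bot hh
  have := A.lcs_anti hk
  rw [h1] at this
  exact h.hne (le_bot_iff.1 this)

theorem finrank_lt (h : A.Bad n m x y) {k : ℕ} (hk : k ≤ n + m - 2) :
    Module.finrank ℂ (A.lcs (k + 1)) < Module.finrank ℂ (A.lcs k) := by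
  apply Submodule.finrank_lt_finrank_of_lt
  exact lt_of_le_not_ge (A.lcs_succ_le k) (h.not_le hk)

theorem top_le (h : A.Bad n m x y) (v : V) :
    ∃ a b : ℂ, ∃ f ∈ A.lcs 1, v = a • x + b • y + f := by
  have hW := h.hgen (Submodule.span ℂ {x, y} ⊔ A.lcs 1)
    (fun z hz => Submodule.mem_sup_left (Submodule.subset_span hz))
    (fun u _ v _ => Submodule.mem_sup_right (A.br_mem_lcs (k := 0) Submodule.mem_top v))
  have hv : v ∈ Submodule.span ℂ {x, y} ⊔ A.lcs 1 := by rw [hW]; trivial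
  obtain ⟨p, hp, f, hf, rfl⟩ := Submodule.mem_sup.1 hv
  obtain ⟨a, b, rfl⟩ := Submodule.mem_span_pair.1 hp
  exact ⟨a, b, f, hf, rfl⟩

theorem finrank_top (h : A.Bad n m x y) : Module.finrank ℂ (A.lcs 0) = n + m := by
  have := Submodule.finrank_add_eq_of_isCompl A.compl
  rw [h.hn, h.hm] at this
  rw [this]
  exact _root_.finrank_top ℂ V

/-- If `L^{k+1}` is spanned by `u` modulo `L^{k+2}`. -/
theorem step_gen (h : A.Bad n m x y) {k : ℕ} {u : V}
    (hu : A.lcs k ≤ Submodule.span ℂ {u} ⊔ A.lcs (k + 1))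
    (h1 : A.br u x ∈ A.lcs (k + 2)) (h2 : A.br u y ∈ A.lcs (k + 2)) :
    A.lcs (k + 1) ≤ A.lcs (k + 2) := by
  refine Submodule.span_le.2 ?_
  rintro z ⟨w, hw, v, -, rfl⟩
  obtain ⟨p, hp, f, hf, rfl⟩ := Submodule.mem_sup.1 (hu hw)
  obtain ⟨c, rfl⟩ := Submodule.mem_span_singleton.1 hp
  have hu' : c • u ∈ A.lcs k := by
    have : c • u = (c • u + f) - f := by abel
    rw [this]
    exact sub_mem hw (A.lcs_succ_le k hf)
  obtain ⟨a, b, g, hg, rfl⟩ := h.top_le v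
  have e1 := A.br_mem_lcs hf (a • x + b • y + g)
  have e2 := A.br_lcs_lcs 1 k _ _ hu' hg
  rw [map_add A.br, LinearMap.add_apply]
  refine add_mem ?_ e1
  rw [map_add]
  refine add_mem ?_ e2
  simp only [map_add, map_smul, LinearMap.smul_apply]
  exact add_mem (Submodule.smul_mem _ _ (Submodule.smul_mem _ _ h1))
    (Submodule.smul_mem _ _ (Submodule.smul_mem _ _ h2))

theorem iter_mem (A : LeibnizSuperAlg V) (w : V) {k : ℕ} {u : V} (hu : u ∈ A.lcs k) (j : ℕ) :
    (A.R w)^[j] u ∈ A.lcs (k + j) := by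
  induction j with
  | zero => exact hu
  | succ j ih => rw [Function.iterate_succ_apply']; exact A.br_mem_lcs ih w

theorem iter_succ (A : LeibnizSuperAlg V) (w u : V) (j : ℕ) :
    (A.R w)^[j + 1] u = A.br ((A.R w)^[j] u) w := by
  rw [Function.iterate_succ_apply']; rfl

theorem four_le (h : A.Bad n m x y) : 4 ≤ n := by
  have := h.hdim
  omega

/-- powers of `R_y` on `y`: the alternating case -/
theorem final_Y (h : A.Bad n m x y)
    (hh : ∀ j ≤ n + m - 2, (A.R y)^[j] y ∉ A.lcs (j + 1)) : False := by
  have hpar : ∀ j, (A.R y)^[2 * j] y ∈ A.L1 ∧ (A.R y)^[2 * j + 1] y ∈ A.L0 := by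
    intro j
    induction j with
    | zero => exact ⟨h.hy, A.grade11 _ h.hy _ h.hy⟩
    | succ j ih =>
      have h1 : (A.R y)^[2 * (j + 1)] y ∈ A.L1 := by
        rw [show 2 * (j + 1) = (2 * j + 1) + 1 by ring, iter_succ]
        exact A.grade01 _ ih.2 _ h.hy
      refine ⟨h1, ?_⟩
      rw [iter_succ]
      exact A.grade11 _ h1 _ h.hy
  have hmem : ∀ j, (A.R y)^[j] y ∈ A.lcs j := by
    intro j
    have := iter_mem A y (k := 0) (u := y) Submodule.mem_top j
    rwa [Nat.zero_add] at this
  have hsq : ∀ j, A.br ((A.R y)^[j] y) (A.br y y) = (2 : ℂ) • (A.R y)^[j + 2] y := by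
    intro j
    rw [A.super_oo _ y h.hy y h.hy, two_smul, iter_succ, iter_succ]
  have hl : ∀ (i : ℕ) (v : V), v ∈ A.lcs0 i → A.br v (A.br y y) ∈ A.lcs0 (i + 1) := by
    intro i v hv
    exact Submodule.subset_span ⟨v, hv, _, A.grade11 _ h.hy _ h.hy, rfl⟩
  have hl' : ∀ (i j : ℕ), (A.R y)^[j] y ∈ A.lcs0 i → (A.R y)^[j + 2] y ∈ A.lcs0 (i + 1) := by
    intro i j hj
    have := hl i _ hj
    rw [hsq] at this
    exact (Submodule.smul_mem_iff _ (by norm_num)).1 this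
  have hs : ∀ i, (A.R y)^[5 + 2 * i] y ∈ A.lcs0 2 := by
    intro i
    have h1 : (A.R y)^[2 * i + 1] y ∈ A.lcs0 0 := (hpar i).2
    have := hl' _ _ (hl' _ _ h1)
    rwa [show 2 * i + 1 + 2 + 2 = 5 + 2 * i by ring] at this
  have h4 := h.four_le
  have c1 := A.count A.L1 0 2 ((n + m - 2) / 2 + 1) (by omega) (by
    intro i hi
    rw [Nat.zero_add]
    exact ⟨_, (hpar i).1, hmem _, hh _ (by omega)⟩)
  have c2 := A.count (A.lcs0 2) 5 2 ((n + m - 5) / 2) (by omega) (by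
    intro i hi
    exact ⟨_, hs i, hmem _, hh _ (by omega)⟩)
  have h5 := h.hdim
  rw [h.hm] at c1
  have := h.hm1
  omega

theorem x_notMem (h : A.Bad n m x y) : x ∉ A.lcs 1 := by
  intro hx
  apply h.final_Y
  have hspan : ∀ j, A.lcs j ≤ Submodule.span ℂ {(A.R y)^[j] y} ⊔ A.lcs (j + 1) := by
    intro j
    induction j with
    | zero =>
      intro v _
      obtain ⟨a, b, f, hf, rfl⟩ := h.top_le v
      rw [show a • x + b • y + f = b • y + (a • x + f) by abel]
      exact Submodule.add_mem_sup
        (Submodule.smul_mem _ _ (Submodule.mem_span_singleton_self _))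
        (add_mem (Submodule.smul_mem _ _ hx) hf)
    | succ j ih =>
      refine Submodule.span_le.2 ?_
      rintro z ⟨w, hw, v, -, rfl⟩
      obtain ⟨p, hp, f, hf, rfl⟩ := Submodule.mem_sup.1 (ih hw)
      obtain ⟨c, rfl⟩ := Submodule.mem_span_singleton.1 hp
      have hm : (A.R y)^[j] y ∈ A.lcs j := by
        have := iter_mem A y (k := 0) (u := y) Submodule.mem_top j
        rwa [Nat.zero_add] at this
      obtain ⟨a, b, g, hg, rfl⟩ := h.top_le v
      have e1 := A.br_mem_lcs hf (a • x + b • y + g)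
      have e2 := A.br_lcs_lcs 1 j _ _ (Submodule.smul_mem _ c hm)
        (add_mem (Submodule.smul_mem _ a hx) hg)
      rw [map_add A.br, LinearMap.add_apply]
      refine add_mem ?_ (Submodule.mem_sup_right e1)
      rw [show a • x + b • y + g = b • y + (a • x + g) by abel, map_add]
      refine add_mem ?_ (Submodule.mem_sup_right e2)
      refine Submodule.mem_sup_left (Submodule.mem_span_singleton.2 ⟨b * c, ?_⟩)
      rw [iter_succ]
      simp only [map_smul, LinearMap.smul_apply, smul_smul]
  intro j hj hmem
  apply h.not_le hj
  refine (hspan j).trans (sup_le ?_ le_rfl)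
  simpa using hmem

theorem y_notMem (h : A.Bad n m x y) : y ∉ A.lcs 1 := by
  intro hy
  have hpar : ∀ j, (A.R x)^[j] x ∈ A.L0 := by
    intro j
    induction j with
    | zero => exact h.hx
    | succ j ih => rw [iter_succ]; exact A.grade00 _ ih _ h.hx
  have hspan : ∀ j, A.lcs j ≤ Submodule.span ℂ {(A.R x)^[j] x} ⊔ A.lcs (j + 1) := by
    intro j
    induction j with
    | zero =>
      intro v _
      obtain ⟨a, b, f, hf, rfl⟩ := h.top_le v
      rw [show a • x + b • y + f = a • x + (b • y + f) by abel]
      exact Submodule.add_mem_sup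
        (Submodule.smul_mem _ _ (Submodule.mem_span_singleton_self _))
        (add_mem (Submodule.smul_mem _ _ hy) hf)
    | succ j ih =>
      refine Submodule.span_le.2 ?_
      rintro z ⟨w, hw, v, -, rfl⟩
      obtain ⟨p, hp, f, hf, rfl⟩ := Submodule.mem_sup.1 (ih hw)
      obtain ⟨c, rfl⟩ := Submodule.mem_span_singleton.1 hp
      have hm : (A.R x)^[j] x ∈ A.lcs j := by
        have := iter_mem A x (k := 0) (u := x) Submodule.mem_top j
        rwa [Nat.zero_add] at this
      obtain ⟨a, b, g, hg, rfl⟩ := h.top_le v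
      have e1 := A.br_mem_lcs hf (a • x + b • y + g)
      have e2 := A.br_lcs_lcs 1 j _ _ (Submodule.smul_mem _ c hm)
        (add_mem (Submodule.smul_mem _ b hy) hg)
      rw [map_add A.br, LinearMap.add_apply]
      refine add_mem ?_ (Submodule.mem_sup_right e1)
      rw [show a • x + b • y + g = a • x + (b • y + g) by abel, map_add]
      refine add_mem ?_ (Submodule.mem_sup_right e2)
      refine Submodule.mem_sup_left (Submodule.mem_span_singleton.2 ⟨a * c, ?_⟩)
      rw [iter_succ]
      simp only [map_smul, LinearMap.smul_apply, smul_smul]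
  have hall : ∀ j, y ∈ A.lcs j := by
    intro j
    induction j with
    | zero => exact Submodule.mem_top
    | succ j ih => exact A.odd_mem (hpar j) h.hy (hspan j ih)
  obtain ⟨s, hs⟩ := h.hnil
  have := hall s
  rw [hs] at this
  exact h.hy0 (by simpa using this)

theorem finrank_eq (h : A.Bad n m x y) {k : ℕ} (hk1 : 1 ≤ k) (hk : k ≤ n + m - 1) :
    Module.finrank ℂ (A.lcs k) = n + m - 1 - k := by
  have h4 := h.four_le
  have h0 := A.finrank_two (k := 0) h.hx h.hy Submodule.mem_top Submodule.mem_top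
    h.x_notMem h.y_notMem
  rw [h.finrank_top] at h0
  have up : ∀ k, k + 1 ≤ n + m - 1 → Module.finrank ℂ (A.lcs (k + 1)) + k + 2 ≤ n + m := by
    intro k
    induction k with
    | zero => intro _; omega
    | succ k ih =>
      intro hk
      have := h.finrank_lt (k := k + 1) (by omega)
      have := ih (by omega)
      omega
  have dn : ∀ j, j ≤ n + m - 1 → j ≤ Module.finrank ℂ (A.lcs (n + m - 1 - j)) := by
    intro j
    induction j with
    | zero => intro _; omega
    | succ j ih =>
      intro hj
      have h1 := h.finrank_lt (k := n + m - 1 - (j + 1)) (by omega)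
      rw [show n + m - 1 - (j + 1) + 1 = n + m - 1 - j by omega] at h1
      have := ih (by omega)
      omega
  have h1 := up (k - 1) (by omega)
  have h2 := dn (n + m - 1 - k) (by omega)
  rw [show k - 1 + 1 = k by omega] at h1
  rw [show n + m - 1 - (n + m - 1 - k) = k by omega] at h2
  omega

theorem bot_of_ge (h : A.Bad n m x y) {k : ℕ} (hk : n + m - 1 ≤ k) : A.lcs k = ⊥ := by
  have h4 := h.four_le
  have h1 := h.finrank_eq (k := n + m - 1) (by omega) le_rfl
  rw [Nat.sub_self] at h1
  have h2 := Submodule.finrank_eq_zero.1 h1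
  have := A.lcs_anti hk
  rw [h2] at this
  exact le_bot_iff.1 this

/-- Of an even and an odd element of `L^{k+1}`, `k ≥ 1`, one is in `L^{k+2}`. -/
theorem dich (h : A.Bad n m x y) {k : ℕ} (hk : 1 ≤ k) {a b : V} (ha : a ∈ A.L0) (hb : b ∈ A.L1)
    (hak : a ∈ A.lcs k) (hbk : b ∈ A.lcs k) : a ∈ A.lcs (k + 1) ∨ b ∈ A.lcs (k + 1) := by
  by_contra hcon
  push Not at hcon
  rcases le_or_gt k (n + m - 2) with hk' | hk'
  · have h4 := h.four_le
    have h1 := A.finrank_two ha hb hak hbk hcon.1 hcon.2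
    rw [h.finrank_eq hk (by omega), h.finrank_eq (k := k + 1) (by omega) (by omega)] at h1
    omega
  · rw [h.bot_of_ge (by omega)] at hak
    rw [(Submodule.mem_bot ℂ).1 hak] at hcon
    exact hcon.1 (zero_mem _)

theorem dich_xy (h : A.Bad n m x y) {k : ℕ} {u : V} (hu : A.Hom u)
    (huk : u ∈ A.lcs k) : A.br u x ∈ A.lcs (k + 2) ∨ A.br u y ∈ A.lcs (k + 2) := by
  rcases hu with hu | hu
  · exact h.dich (k := k + 1) (by omega) (A.grade00 _ hu _ h.hx) (A.grade01 _ hu _ h.hy)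
      (A.br_mem_lcs huk _) (A.br_mem_lcs huk _)
  · exact (h.dich (k := k + 1) (by omega) (A.grade11 _ hu _ h.hy) (A.grade10 _ hu _ h.hx)
      (A.br_mem_lcs huk _) (A.br_mem_lcs huk _)).symm

theorem span_le (h : A.Bad n m x y) {k : ℕ} (hk : 1 ≤ k) {u : V} (hu : u ∈ A.lcs k)
    (hu' : u ∉ A.lcs (k + 1)) : A.lcs k ≤ Submodule.span ℂ {u} ⊔ A.lcs (k + 1) := by
  have h4 := h.four_le
  rcases le_or_gt k (n + m - 2) with hk' | hk'
  · have h1 := finrank_lt_sup _ hu'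
    rw [h.finrank_eq (k := k + 1) (by omega) (by omega)] at h1
    have h2 := h.finrank_eq hk (by omega)
    have h3 : Submodule.span ℂ {u} ⊔ A.lcs (k + 1) ≤ A.lcs k :=
      sup_le (by simpa using hu) (A.lcs_succ_le k)
    exact (Submodule.eq_of_le_of_finrank_le h3 (by omega)).ge
  · rw [h.bot_of_ge (by omega)]
    exact bot_le

theorem step (h : A.Bad n m x y) {k : ℕ} (hk : 1 ≤ k) (hk' : k + 1 ≤ n + m - 2) {u : V}
    (hu : u ∈ A.lcs k) (hu' : u ∉ A.lcs (k + 1)) :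
    A.br u x ∉ A.lcs (k + 2) ∨ A.br u y ∉ A.lcs (k + 2) := by
  by_contra hcon
  push Not at hcon
  exact h.not_le hk' (h.step_gen (h.span_le hk hu hu') hcon.1 hcon.2)

theorem hom_x (h : A.Bad n m x y) {u : V} (hu : A.Hom u) : A.Hom (A.br u x) :=
  hu.imp (fun hu => A.grade00 _ hu _ h.hx) (fun hu => A.grade10 _ hu _ h.hx)

theorem hom_y (h : A.Bad n m x y) {u : V} (hu : A.Hom u) : A.Hom (A.br u y) :=
  hu.symm.imp (fun hu => A.grade11 _ hu _ h.hy) (fun hu => A.grade01 _ hu _ h.hy)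

/-- Too many odd vectors of the form `z X^j`. -/
theorem odd_X (h : A.Bad n m x y) {z : V} (hz : z ∈ A.L1) (hz1 : z ∈ A.lcs 1) (r : ℕ)
    (hr : ∀ j < r, (A.R x)^[j] z ∉ A.lcs (j + 2)) : r + 1 ≤ m := by
  have hpar : ∀ j, (A.R x)^[j] z ∈ A.L1 := by
    intro j
    induction j with
    | zero => exact hz
    | succ j ih => rw [iter_succ]; exact A.grade10 _ ih _ h.hx
  have c := A.count A.L1 0 1 (r + 1) le_rfl (by
    intro i hi
    rw [Nat.zero_add, Nat.one_mul]
    rcases i with _ | i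
    · exact ⟨y, h.hy, Submodule.mem_top, h.y_notMem⟩
    · refine ⟨_, hpar i, ?_, hr i (by omega)⟩
      rw [Nat.add_comm]
      exact iter_mem A x hz1 i)
  rwa [h.hm] at c

theorem no_X (h : A.Bad n m x y)
    (hc : ∀ (k : ℕ) (u : V), u ∈ A.lcs k →
      A.br (A.br u x) y - A.br (A.br u y) x ∈ A.lcs (k + 3))
    {z : V} (hz : A.Hom z) (hz1 : z ∈ A.lcs 1) (hz2 : z ∉ A.lcs 2) :
    A.br z x ∈ A.lcs 3 := by
  by_contra hzx
  have h4 := h.four_le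
  have hm1 := h.hm1
  have hhom : ∀ j, A.Hom ((A.R x)^[j] z) := by
    intro j
    induction j with
    | zero => exact hz
    | succ j ih => rw [iter_succ]; exact h.hom_x ih
  have hmem : ∀ j, (A.R x)^[j] z ∈ A.lcs (j + 1) := by
    intro j
    rw [Nat.add_comm]
    exact iter_mem A x hz1 j
  have key : ∀ j, j + 2 ≤ n + m - 2 → (A.R x)^[j + 1] z ∉ A.lcs (j + 3) := by
    intro j
    induction j with
    | zero => intro _; exact hzx
    | succ j ih =>
      intro hj
      have h1 := ih (by omega)
      have h2 : A.br ((A.R x)^[j] z) y ∈ A.lcs (j + 3) := by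
        rcases h.dich_xy (hhom j) (hmem j) with h2 | h2
        · rw [← iter_succ] at h2
          exact absurd h2 h1
        · exact h2
      have h3 := A.br_mem_lcs h2 x
      have h5 := hc _ _ (hmem j)
      have h6 : A.br ((A.R x)^[j + 1] z) y ∈ A.lcs (j + 4) := by
        rw [iter_succ]
        have := add_mem h5 h3
        rwa [sub_add_cancel] at this
      rw [iter_succ]
      rcases h.step (k := j + 2) (by omega) (by omega) (hmem (j + 1)) h1 with h7 | h7
      · exact h7
      · exact absurd h6 h7
  have key' : ∀ j < n + m - 2, (A.R x)^[j] z ∉ A.lcs (j + 2) := by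
    intro j hj
    rcases j with _ | j
    · exact hz2
    · exact key j (by omega)
  rcases hz with hz | hz
  · have hs : ∀ j, (A.R x)^[j] z ∈ A.L0 := by
      intro j
      induction j with
      | zero => exact hz
      | succ j ih => rw [iter_succ]; exact A.grade00 _ ih _ h.hx
    have hl : ∀ (i : ℕ) (v : V), v ∈ A.lcs0 i → A.br v x ∈ A.lcs0 (i + 1) := by
      intro i v hv
      exact Submodule.subset_span ⟨v, hv, _, h.hx, rfl⟩
    have c := A.count (A.lcs0 2) 3 1 (n + m - 4) le_rfl (by
      intro i hi
      refine ⟨(A.R x)^[i + 2] z, ?_, ?_, ?_⟩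
      · rw [iter_succ, iter_succ]
        exact hl _ _ (hl _ _ (hs i))
      · rw [show 3 + 1 * i = i + 2 + 1 by ring]
        exact hmem _
      · rw [show 3 + 1 * i + 1 = i + 2 + 2 by ring]
        exact key' _ (by omega))
    have := h.hdim
    omega
  · have := h.odd_X hz hz1 _ key'
    omega

theorem case_one (h : A.Bad n m x y)
    (hc : ∀ (k : ℕ) (u : V), u ∈ A.lcs k →
      A.br (A.br u x) y - A.br (A.br u y) x ∈ A.lcs (k + 3)) : False := by
  have h4 := h.four_le
  have hm1 := h.hm1
  have keyY : ∀ z, A.Hom z → z ∈ A.lcs 1 → z ∉ A.lcs 2 →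
      ∀ j < n + m - 2, (A.R y)^[j] z ∉ A.lcs (j + 2) := by
    intro z hz hz1 hz2
    have hzx := h.no_X hc hz hz1 hz2
    have hmem : ∀ j, (A.R y)^[j] z ∈ A.lcs (j + 1) := by
      intro j
      rw [Nat.add_comm]
      exact iter_mem A y hz1 j
    have hx : ∀ j, A.br ((A.R y)^[j] z) x ∈ A.lcs (j + 3) := by
      intro j
      induction j with
      | zero => exact hzx
      | succ j ih =>
        rw [iter_succ]
        have h3 := A.br_mem_lcs ih y
        have h5 := hc _ _ (hmem j)
        have := sub_mem h3 h5
        rwa [sub_sub_cancel] at this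
    intro j
    induction j with
    | zero => intro _; exact hz2
    | succ j ih =>
      intro hj
      rw [iter_succ]
      rcases h.step (k := j + 1) (by omega) (by omega) (hmem j) (ih (by omega)) with h7 | h7
      · exact absurd (hx j) h7
      · exact h7
  have hex : ∃ z, A.Hom z ∧ z ∈ A.lcs 1 ∧ z ∉ A.lcs 2 := by
    by_contra hcon
    push Not at hcon
    apply h.not_le (k := 1) (by omega)
    intro v hv
    obtain ⟨a, ha, b, hb, hak, hbk, rfl⟩ := A.exists_decomp 1 v hv
    exact add_mem (hcon a (Or.inl ha) hak) (hcon b (Or.inr hb) hbk)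
  obtain ⟨z, hz, hz1, hz2⟩ := hex
  have hzyy := keyY z hz hz1 hz2 2 (by omega)
  have he1 : A.br y y ∈ A.lcs 1 := A.br_mem_lcs (k := 0) Submodule.mem_top y
  have he2 : A.br y y ∉ A.lcs 2 := by
    intro he
    have h1 := A.br_lcs_lcs 2 1 _ _ hz1 he
    rw [A.super_oo _ y h.hy y h.hy, ← two_smul ℂ] at h1
    exact hzyy ((Submodule.smul_mem_iff _ (by norm_num)).1 h1)
  have hk := keyY _ (Or.inl (A.grade11 _ h.hy _ h.hy)) he1 he2
  apply h.final_Y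
  intro j hj
  rcases j with _ | j
  · exact h.y_notMem
  · exact hk j (by omega)

theorem case_two (h : A.Bad n m x y) (hxy : A.br x y ∉ A.lcs 2)
    (hyx : A.br y x + A.br x y ∈ A.lcs 2) : False := by
  have h4 := h.four_le
  have hm1 := h.hm1
  have hz1 : A.br x y ∈ A.lcs 1 := A.br_mem_lcs (k := 0) Submodule.mem_top y
  have hzo : A.br x y ∈ A.L1 := A.grade01 _ h.hx _ h.hy
  have hyy : A.br y y ∈ A.lcs 2 := by
    rcases h.dich (k := 1) le_rfl (A.grade11 _ h.hy _ h.hy) hzo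
      (A.br_mem_lcs (k := 0) Submodule.mem_top y) hz1 with h1 | h1
    · exact h1
    · exact absurd h1 hxy
  obtain ⟨z, hz⟩ : ∃ z : ℕ → V, ∀ j, z j = (A.R x)^[j] (A.br x y) := ⟨_, fun _ => rfl⟩
  obtain ⟨u, hu⟩ : ∃ u : ℕ → V, ∀ j, u j = (A.R x)^[j] y := ⟨_, fun _ => rfl⟩
  have z0 : z 0 = A.br x y := hz 0
  have u0 : u 0 = y := hu 0
  have zs : ∀ j, z (j + 1) = A.br (z j) x := by intro j; rw [hz, hz, iter_succ]
  have us : ∀ j, u (j + 1) = A.br (u j) x := by intro j; rw [hu, hu, iter_succ]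
  have zmem : ∀ j, z j ∈ A.lcs (j + 1) := by
    intro j
    rw [Nat.add_comm, hz]
    exact iter_mem A x hz1 j
  have umem : ∀ j, u j ∈ A.lcs j := by
    intro j
    have := iter_mem A x (k := 0) (u := y) Submodule.mem_top j
    rwa [Nat.zero_add, ← hu] at this
  have zodd : ∀ j, z j ∈ A.L1 := by
    intro j
    induction j with
    | zero => rw [z0]; exact hzo
    | succ j ih => rw [zs]; exact A.grade10 _ ih _ h.hx
  have uz : ∀ j, u (j + 1) + z j ∈ A.lcs (j + 2) := by
    intro j
    induction j with
    | zero => rw [us, u0, z0]; exact hyx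
    | succ j ih =>
      have := A.br_mem_lcs ih x
      rw [map_add, LinearMap.add_apply, ← us, ← zs] at this
      exact this
  have hrz0 : ∀ v, A.br v (z 0) = A.br (A.br v x) y - A.br (A.br v y) x := by
    intro v
    rw [z0, A.super_eo v x h.hx y h.hy]
  have hrz : ∀ v j, A.br v (z (j + 1)) = A.br (A.br v (z j)) x - A.br (A.br v x) (z j) := by
    intro v j
    rw [zs, A.super_oe v _ (zodd j) x h.hx]
  -- the first exit of the string `z j`
  have hex : ∃ j, z j ∈ A.lcs (j + 2) := by
    by_contra hcon
    push Not at hcon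
    have := h.odd_X hzo hz1 m (fun j _ => by rw [← hz]; exact hcon j)
    omega
  classical
  have hfs := Nat.find_spec hex
  have hfm : ∀ j < Nat.find hex, z j ∉ A.lcs (j + 2) := fun j hj => Nat.find_min hex hj
  rcases hq : Nat.find hex with _ | p
  · rw [hq, z0] at hfs
    exact hxy hfs
  rw [hq] at hfs hfm
  have hcnt := h.odd_X hzo hz1 (p + 1) (fun j hj => by rw [← hz]; exact hfm j hj)
  -- `u i Y` for `i ≤ p`
  have uY : ∀ i ≤ p, A.br (u i) y ∈ A.lcs (i + 2) := by
    intro i hi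
    rcases i with _ | i
    · rw [u0]; exact hyy
    · have h1 : A.br (z i) y ∈ A.lcs (i + 3) := by
        rcases h.dich_xy (Or.inr (zodd i)) (zmem i) with h1 | h1
        · rw [← zs] at h1
          exact absurd h1 (hfm (i + 1) (by omega))
        · exact h1
      have h2 := A.br_mem_lcs (uz i) y
      rw [map_add, LinearMap.add_apply] at h2
      have := sub_mem h2 h1
      rwa [add_sub_cancel_right] at this
  have up2 : u (p + 2) ∈ A.lcs (p + 3) := by
    have := sub_mem (uz (p + 1)) hfs
    rwa [add_sub_cancel_right] at this
  obtain ⟨t, ht⟩ : ∃ t, t = A.br (u (p + 1)) y := ⟨_, rfl⟩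
  have tmem : t ∈ A.lcs (p + 2) := by rw [ht]; exact A.br_mem_lcs (umem _) y
  have tnot : t ∉ A.lcs (p + 3) := by
    intro htm
    have h1 := A.br_mem_lcs (uz p) y
    rw [map_add, LinearMap.add_apply, ← ht] at h1
    have h2 := sub_mem h1 htm
    rw [add_sub_cancel_left] at h2
    rcases h.step (k := p + 1) (by omega) (by omega) (zmem p) (hfm p (by omega)) with h3 | h3
    · rw [← zs] at h3
      exact h3 hfs
    · exact h3 h2
  have B1 : ∀ j i, i + j + 1 ≤ p → A.br (u i) (z j) ∈ A.lcs (i + j + 3) := by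
    intro j
    induction j with
    | zero =>
      intro i hi
      rw [hrz0, ← us]
      exact sub_mem (uY (i + 1) (by omega)) (A.br_mem_lcs (uY i (by omega)) x)
    | succ j ih =>
      intro i hi
      rw [hrz, ← us]
      have h1 := A.br_mem_lcs (ih i (by omega)) x
      have h2 := ih (i + 1) (by omega)
      rw [show i + 1 + j + 3 = i + (j + 1) + 3 by ring] at h2
      exact sub_mem h1 h2
  have B2 : ∀ j i, i + j = p → A.br (u i) (z j) - ((-1 : ℂ) ^ j) • t ∈ A.lcs (p + 3) := by
    intro j
    induction j with
    | zero =>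
      intro i hi
      obtain rfl : i = p := by omega
      rw [hrz0, ← us, ← ht, pow_zero, one_smul, sub_sub_cancel_left]
      exact neg_mem (A.br_mem_lcs (uY i le_rfl) x)
    | succ j ih =>
      intro i hi
      rw [hrz, ← us]
      have h1 := A.br_mem_lcs (B1 j i (by omega)) x
      rw [show i + j + 3 + 1 = p + 3 by omega] at h1
      have h2 := ih (i + 1) (by omega)
      have := sub_mem h1 h2
      convert this using 1
      rw [pow_succ]
      module
  have B3 : ∀ j i, i + j = p + 1 →
      A.br (u i) (z j) + ((-1 : ℂ) ^ j * (j + 1)) • A.br t x ∈ A.lcs (p + 4) := by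
    intro j
    induction j with
    | zero =>
      intro i hi
      obtain rfl : i = p + 1 := by omega
      rw [hrz0, ← us, ← ht]
      have h1 := A.br_mem_lcs up2 y
      convert h1 using 1
      simp
    | succ j ih =>
      intro i hi
      rw [hrz, ← us]
      have h1 := A.br_mem_lcs (B2 j i (by omega)) x
      rw [map_sub, LinearMap.sub_apply, map_smul, LinearMap.smul_apply] at h1
      have h2 := ih (i + 1) (by omega)
      have := sub_mem h1 h2
      convert this using 1
      rw [pow_succ]
      push_cast
      module
  have hX : A.br t x ∈ A.lcs (p + 4) := by
    have h1 := B3 (p + 1) 0 (by omega)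
    have h2 := A.br_lcs_lcs (p + 3) 0 _ _ (umem 0) hfs
    rw [Nat.zero_add] at h2
    have h3 := sub_mem h1 h2
    rw [add_sub_cancel_left] at h3
    refine (Submodule.smul_mem_iff _ ?_).1 h3
    refine mul_ne_zero (pow_ne_zero _ (by norm_num)) ?_
    exact_mod_cast Nat.succ_ne_zero (p + 1)
  have hY : A.br t y ∈ A.lcs (p + 4) := by
    have h1 := A.br_lcs_lcs 2 (p + 1) _ _ (umem (p + 1)) hyy
    rw [A.super_oo _ y h.hy y h.hy, ← two_smul ℂ, ← ht] at h1
    exact (Submodule.smul_mem_iff _ (by norm_num)).1 h1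
  rcases h.step (k := p + 2) (by omega) (by omega) tmem tnot with h3 | h3
  · exact h3 hX
  · exact h3 hY

theorem false (h : A.Bad n m x y) : False := by
  by_cases hc : ∀ (k : ℕ) (u : V), u ∈ A.lcs k →
      A.br (A.br u x) y - A.br (A.br u y) x ∈ A.lcs (k + 3)
  · exact h.case_one hc
  have hxy : A.br x y ∉ A.lcs 2 := by
    intro hxy
    apply hc
    intro k u hu
    rw [← A.super_eo u x h.hx y h.hy]
    exact A.br_lcs_lcs 2 k _ _ hu hxy
  refine h.case_two hxy ?_
  have h1 := h.span_le le_rfl (A.br_mem_lcs (k := 0) Submodule.mem_top y) hxy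
    (A.br_mem_lcs (k := 0) (u := y) Submodule.mem_top x)
  obtain ⟨q, hq, f, hf, hqf⟩ := Submodule.mem_sup.1 h1
  obtain ⟨c, rfl⟩ := Submodule.mem_span_singleton.1 hq
  by_cases hc1 : 1 + c = 0
  · rw [← hqf, show c • A.br x y + f + A.br x y = (1 + c) • A.br x y + f by module, hc1,
      zero_smul, zero_add]
    exact hf
  · exfalso
    apply hc
    intro k u hu
    have h2 := A.br_lcs_lcs 2 k _ _ hu hf
    have h3 : f = A.br y x - c • A.br x y := by rw [← hqf]; abel
    rw [h3, map_sub, map_smul, A.super_oe u y h.hy x h.hx, A.super_eo u x h.hx y h.hy] at h2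
    have h4 := neg_mem h2
    refine (Submodule.smul_mem_iff _ hc1).1 ?_
    convert h4 using 1
    module

end Bad

end Helpers

end LeibnizSuperAlg

/-- A nilpotent complex Leibniz superalgebra with `dim L₀ = n`,
`dim L₁ = m`, generated by `x₁ ∈ L₀` and `y₁ ∈ L₁` with an adapted basis
`y₁,…,y_m` of `L₁`, such that `dim L₀³ ≤ n − 4`, has nilindex less than `n + m`,
i.e. `L^{n+m−1} = 0`. -/
theorem statement2 {V : Type*} [AddCommGroup V] [Module ℂ V] [FiniteDimensional ℂ V]
    (A : LeibnizSuperAlg V) (n m : ℕ)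
    (hn : Module.finrank ℂ A.L0 = n) (hm : Module.finrank ℂ A.L1 = m)
    (hm1 : 1 ≤ m)
    (hnil : A.IsNilpotent)
    (x₁ : V) (hx₁ : x₁ ∈ A.L0)
    (y : Fin m → V) (hyL1 : ∀ i, y i ∈ A.L1)
    (hyind : LinearIndependent ℂ y)
    (hyspan : Submodule.span ℂ (Set.range y) = A.L1)
    (hgen : A.Generates {x₁, y ⟨0, by omega⟩})
    (hrel : ∀ i : ℕ, ∀ h : i + 1 < m, A.br (y ⟨i, by omega⟩) x₁ = y ⟨i + 1, h⟩)
    (hlast : A.br (y ⟨m - 1, by omega⟩) x₁ = 0)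
    (hdim : (Module.finrank ℂ (A.lcs0 2) : ℤ) ≤ (n : ℤ) - 4) :
    A.lcs (n + m - 2) = ⊥ := by
  by_contra hne
  have hb : A.Bad n m x₁ (y ⟨0, by omega⟩) :=
    { hn := hn, hm := hm, hm1 := hm1, hnil := hnil, hx := hx₁, hy := hyL1 _,
      hy0 := hyind.ne_zero _, hgen := hgen, hdim := by omega, hne := hne }
  exact hb.false
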